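/- In the warm-up configuration with parameter α > 0, for every n such that the trap anchored at (d_n,0) = (n³,0) is present, the β-biased random walk (β > 1) started at the anchor (d_n,0) never returns to (d_n,0) with probability exactly (β−1)/(β+2). -/

import Mathlib

open MeasureTheory Filter
open scoped ENNReal

noncomputable section

/-- Vertices of the square lattice. -/
abbrev V : Type := ℤ × ℤ

/-- Adjacency in the square lattice ℤ²: Euclidean distance one. -/
def latAdj (u v : V) : Prop := (u.1 - v.1) ^ 2 + (u.2 - v.2) ^ 2 = 1

instance : MeasurableSpace (Sym2 V) := ⊤

open scoped Classical in
/-- One-step transition probability of the β-biased random walk on the subgraph of ℤ²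
with edge set `G`: if the set `Λ` of neighbours of `z` is nonempty and contains the right
neighbour `(z.1+1, z.2)`, step to it with probability `β/(β+|Λ|-1)` and to each other
neighbour with probability `1/(β+|Λ|-1)`; if `Λ` does not contain the right neighbour, step
uniformly in `Λ`; if `Λ` is empty, stay put. -/
def transProb (β : ℝ) (G : Set (Sym2 V)) (z w : V) : ℝ :=
  if {u : V | s(z, u) ∈ G} = ∅ then (if w = z then 1 else 0)
  else
    if s(z, w) ∈ G then
      (if s(z, ((z.1 + 1, z.2) : V)) ∈ G then
        (if w = ((z.1 + 1, z.2) : V) then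
          β / (β + ({u : V | s(z, u) ∈ G}.ncard : ℝ) - 1)
        else 1 / (β + ({u : V | s(z, u) ∈ G}.ncard : ℝ) - 1))
      else 1 / ({u : V | s(z, u) ∈ G}.ncard : ℝ))
    else 0

/-- `μ` is the law of the β-biased random walk on the subgraph of ℤ² with edge set `G`,
started at `z₀`: a probability measure on trajectories whose cylinder probabilities are
the products of the one-step transition probabilities. -/
def IsWalkLaw (β : ℝ) (G : Set (Sym2 V)) (z₀ : V) (μ : Measure (ℕ → V)) : Prop :=
  IsProbabilityMeasure μ ∧
    ∀ (n : ℕ) (f : ℕ → V), f 0 = z₀ →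
      μ {ω | ∀ i ≤ n, ω i = f i} =
        ENNReal.ofReal (∏ i ∈ Finset.range n, transProb β G (f i) (f (i + 1)))

/-- The trap with anchor `(d, y)`, entrance length `e` (at height `y+1`, running leftward
from the anchor) and core length `c` (at height `y+2`, running rightward). -/
def trapEdgesAt (d y : ℤ) (e c : ℕ) : Set (Sym2 V) :=
  {s((d, y), (d, y + 1)), s((d - e, y + 1), (d - e, y + 2))} ∪
    {f | ∃ i : ℕ, i < e ∧ f = s((d - e + i, y + 1), (d - e + i + 1, y + 1))} ∪
    {f | ∃ i : ℕ, i < c ∧ f = s((d - e + i, y + 2), (d - e + i + 1, y + 2))}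

/-- Anchors of the warm-up traps: `d_n = n³`. -/
def dWarm (n : ℕ) : ℤ := (n : ℤ) ^ 3

/-- Entrance lengths of the warm-up traps: `e_n = ⌈α · log n⌉`. -/
def eWarm (α : ℝ) (n : ℕ) : ℕ := ⌈α * Real.log n⌉₊

/-- Core lengths of the warm-up traps: `c_n = n`. -/
def cWarm (n : ℕ) : ℕ := n

/-- The warm-up configuration: the nonnegative x-axis together with, for every `n ≥ n₀`,
the trap with anchor `(n³, 0)`, entrance length `⌈α log n⌉` and core length `n`. -/
def warmupEdges (α : ℝ) (n₀ : ℕ) : Set (Sym2 V) :=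
  {f | ∃ k : ℕ, f = s(((k : ℤ), 0), ((k : ℤ) + 1, 0))} ∪
    ⋃ n ∈ {m : ℕ | n₀ ≤ m}, trapEdgesAt (dWarm n) 0 (eWarm α n) (cWarm n)

/-- `n₀` is large enough that the traps present in the warm-up configuration are pairwise
disjoint: for `n₀ ≤ m < n`, both the anchor of trap `m` and the right end of its core lie
strictly to the left of the leftmost point of trap `n`. -/
def WarmupSeparated (α : ℝ) (n₀ : ℕ) : Prop :=
  ∀ m n : ℕ, n₀ ≤ m → m < n →
    dWarm m < dWarm n - eWarm α n ∧ dWarm m - eWarm α m + cWarm m < dWarm n - eWarm α n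

/-- Trajectories that avoid `o` at all times `1, …, t`. -/
def avoidUpTo {S : Type*} (o : S) (t : ℕ) : Set (ℕ → S) := {ω | ∀ s, 1 ≤ s → s ≤ t → ω s ≠ o}

lemma avoidUpTo_succ {S : Type*} (o : S) (t : ℕ) :
    avoidUpTo o (t + 1) = avoidUpTo o t ∩ {ω | ω (t + 1) ≠ o} := by
  ext ω
  simp only [avoidUpTo, Set.mem_ofPred_eq, Set.mem_inter_iff]
  constructor
  · exact fun h => ⟨fun s h1 h2 => h s h1 (by omega), h _ (by omega) le_rfl⟩
  · rintro ⟨h1, h2⟩ s hs hst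
    rcases Nat.le_succ_iff.1 hst with h | rfl
    · exact h1 s hs h
    · exact h2

section KilledChain

variable {S : Type*} [MeasurableSpace S] [MeasurableSingletonClass S]

lemma measurableSet_eq_at (i : ℕ) (z : S) : MeasurableSet {ω : ℕ → S | ω i = z} := by
  have h : {ω : ℕ → S | ω i = z} = (fun ω : ℕ → S => ω i) ⁻¹' {z} := by ext; simp
  rw [h]
  exact measurable_pi_apply i (measurableSet_singleton z)

lemma measurableSet_cylinder (t : ℕ) (x : ℕ → S) :
    MeasurableSet {ω : ℕ → S | ∀ i ≤ t, ω i = x i} := by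
  simp only [Set.ofPred_forall]
  exact MeasurableSet.iInter fun i => MeasurableSet.iInter fun _ =>
    measurableSet_eq_at i (x i)

lemma measurableSet_avoidUpTo (o : S) (t : ℕ) : MeasurableSet (avoidUpTo o t) := by
  simp only [avoidUpTo, Set.ofPred_forall]
  exact MeasurableSet.iInter fun i => MeasurableSet.iInter fun _ => MeasurableSet.iInter fun _ =>
    (measurableSet_eq_at i o).compl

variable [Countable S]

lemma setLIntegral_cylinder_next {p : S → S → ℝ≥0∞} {o : S} {μ : Measure (ℕ → S)}
    [IsProbabilityMeasure μ]
    (hμ : ∀ (n : ℕ) (x : ℕ → S), x 0 = o →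
      μ {ω | ∀ i ≤ n, ω i = x i} = ∏ i ∈ Finset.range n, p (x i) (x (i + 1)))
    (g : S → ℝ≥0∞) (t : ℕ) (x : ℕ → S) :
    ∫⁻ ω in {ω | ∀ i ≤ t, ω i = x i}, g (ω (t + 1)) ∂μ =
      ∫⁻ ω in {ω | ∀ i ≤ t, ω i = x i}, (∑' w, p (ω t) w * g w) ∂μ := by
  have hg : Measurable g := measurable_of_countable g
  have hC := measurableSet_cylinder t x
  by_cases hx : x 0 = o
  · have hr : ∫⁻ ω in {ω | ∀ i ≤ t, ω i = x i}, (∑' w, p (ω t) w * g w) ∂μ =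
        (∑' w, p (x t) w * g w) * μ {ω | ∀ i ≤ t, ω i = x i} := by
      rw [← setLIntegral_const]
      exact setLIntegral_congr_fun hC fun ω hω => by simp only [hω t le_rfl]
    rw [hr, ← lintegral_map (μ := μ.restrict {ω | ∀ i ≤ t, ω i = x i}) hg
      (measurable_pi_apply (t + 1)), lintegral_countable', ← ENNReal.tsum_mul_right]
    refine tsum_congr fun w => ?_
    rw [Measure.map_apply (measurable_pi_apply _) (measurableSet_singleton w),
      Measure.restrict_apply (measurable_pi_apply _ (measurableSet_singleton w))]
    have hset : (fun ω : ℕ → S => ω (t + 1)) ⁻¹' {w} ∩ {ω | ∀ i ≤ t, ω i = x i} =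
        {ω | ∀ i ≤ t + 1, ω i = Function.update x (t + 1) w i} := by
      ext ω
      simp only [Set.mem_inter_iff, Set.mem_preimage, Set.mem_singleton_iff, Set.mem_ofPred_eq]
      constructor
      · rintro ⟨h1, h2⟩ i hi
        rcases Nat.le_succ_iff.1 hi with h | rfl
        · rw [Function.update_of_ne (by omega)]; exact h2 i h
        · simpa using h1
      · intro h
        refine ⟨by simpa using h (t + 1) le_rfl, fun i hi => ?_⟩
        have := h i (by omega)
        rwa [Function.update_of_ne (by omega)] at this
    rw [hset, hμ (t + 1) _ (by rw [Function.update_of_ne (by omega)]; exact hx), hμ t x hx,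
      Finset.prod_range_succ, Function.update_self, Function.update_of_ne (by omega)]
    have : ∏ i ∈ Finset.range t, p (Function.update x (t + 1) w i)
        (Function.update x (t + 1) w (i + 1)) = ∏ i ∈ Finset.range t, p (x i) (x (i + 1)) := by
      refine Finset.prod_congr rfl fun i hi => ?_
      have := Finset.mem_range.1 hi
      rw [Function.update_of_ne (by omega), Function.update_of_ne (by omega)]
    rw [this]
    ring
  · have h0 : μ {ω | ∀ i ≤ t, ω i = x i} = 0 := by
      have h1 : μ {ω : ℕ → S | ω 0 = o} = 1 := by
        simpa using hμ 0 (fun _ => o) rfl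
      have h2 : μ {ω : ℕ → S | ω 0 = o}ᶜ = 0 :=
        (prob_compl_eq_zero_iff (measurableSet_eq_at 0 o)).2 h1
      exact measure_mono_null (fun ω hω h => hx ((hω 0 (Nat.zero_le t)).symm.trans h)) h2
    rw [setLIntegral_measure_zero _ _ h0, setLIntegral_measure_zero _ _ h0]

/-- The Markov property on an event determined by the first `t + 1` coordinates. -/
lemma setLIntegral_next {p : S → S → ℝ≥0∞} {o : S} {μ : Measure (ℕ → S)}
    [IsProbabilityMeasure μ]
    (hμ : ∀ (n : ℕ) (x : ℕ → S), x 0 = o →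
      μ {ω | ∀ i ≤ n, ω i = x i} = ∏ i ∈ Finset.range n, p (x i) (x (i + 1)))
    (g : S → ℝ≥0∞) (t : ℕ) {A : Set (ℕ → S)}
    (hA : ∀ ω ∈ A, ∀ ω' : ℕ → S, (∀ i ≤ t, ω' i = ω i) → ω' ∈ A) :
    ∫⁻ ω in A, g (ω (t + 1)) ∂μ = ∫⁻ ω in A, (∑' w, p (ω t) w * g w) ∂μ := by
  let e : (Fin (t + 1) → S) → ℕ → S := fun x i => x (Fin.ofNat (t + 1) i)
  have he : ∀ ω : ℕ → S, ∀ i ≤ t, ω i = e (fun j => ω j) i := by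
    intro ω i hi
    simp [e, Nat.mod_eq_of_lt (Nat.lt_succ_of_le hi)]
  let I := {x : Fin (t + 1) → S // e x ∈ A}
  have hU : A = ⋃ x : I, {ω | ∀ i ≤ t, ω i = e x.1 i} := by
    ext ω
    simp only [Set.mem_iUnion, Set.mem_ofPred_eq]
    constructor
    · intro hω
      exact ⟨⟨fun j => ω j, hA ω hω _ fun i hi => (he ω i hi).symm⟩, he ω⟩
    · rintro ⟨x, hx⟩
      exact hA _ x.2 ω hx
  have hd : Pairwise (Function.onFun Disjoint
      fun x : I => {ω : ℕ → S | ∀ i ≤ t, ω i = e x.1 i}) := by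
    intro x y hxy
    rw [Function.onFun, Set.disjoint_left]
    intro ω hx hy
    refine hxy (Subtype.ext (funext fun j => ?_))
    have hj : (j : ℕ) ≤ t := Nat.lt_succ_iff.1 j.2
    have := (hx j hj).symm.trans (hy j hj)
    simpa [e] using this
  rw [hU, lintegral_iUnion (fun x => measurableSet_cylinder t _) hd,
    lintegral_iUnion (fun x => measurableSet_cylinder t _) hd]
  exact tsum_congr fun x => setLIntegral_cylinder_next hμ g t _

lemma setLIntegral_avoidUpTo_next {p : S → S → ℝ≥0∞} {o : S} {μ : Measure (ℕ → S)}
    [IsProbabilityMeasure μ]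
    (hμ : ∀ (n : ℕ) (x : ℕ → S), x 0 = o →
      μ {ω | ∀ i ≤ n, ω i = x i} = ∏ i ∈ Finset.range n, p (x i) (x (i + 1)))
    (g : S → ℝ≥0∞) (t : ℕ) :
    ∫⁻ ω in avoidUpTo o t, (∑' w, p (ω t) w * g w) ∂μ =
      ∫⁻ ω in avoidUpTo o (t + 1), g (ω (t + 1)) ∂μ +
        g o * μ (avoidUpTo o t \ avoidUpTo o (t + 1)) := by
  have hsub : avoidUpTo o (t + 1) ⊆ avoidUpTo o t := by
    rw [avoidUpTo_succ]; exact Set.inter_subset_left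
  have hB := measurableSet_avoidUpTo o (t + 1)
  have hA : ∀ ω ∈ avoidUpTo o t, ∀ ω' : ℕ → S, (∀ i ≤ t, ω' i = ω i) → ω' ∈ avoidUpTo o t :=
    fun ω hω ω' h s h1 h2 => by rw [h s h2]; exact hω s h1 h2
  rw [← setLIntegral_next hμ g t hA, ← lintegral_inter_add_sdiff _ (avoidUpTo o t) hB, Set.inter_eq_right.2 hsub]
  congr 1
  rw [← setLIntegral_const]
  refine setLIntegral_congr_fun ((measurableSet_avoidUpTo o t).diff hB) fun ω hω => ?_
  have : ω (t + 1) = o := by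
    by_contra h
    exact hω.2 (by rw [avoidUpTo_succ]; exact ⟨hω.1, h⟩)
  simp only [this]

lemma tendsto_zero_of_two_mul_le {c q : ℕ → ℝ} (hc0 : ∀ t, 0 ≤ c t) (hc1 : ∀ t, c t ≤ 1)
    (h : ∀ t, 1 ≤ t → 2 * c t ≤ c (t + 1) + q t) (hq : Tendsto q atTop (nhds 0)) :
    Tendsto c atTop (nhds 0) := by
  rw [Metric.tendsto_atTop]
  intro ε hε
  obtain ⟨N, hN⟩ := Metric.tendsto_atTop.1 hq (ε / 2) (by positivity)
  have key : ∀ k : ℕ, ∀ t ≥ N + 1, c t ≤ ε / 2 + (1 / 2) ^ k := by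
    intro k
    induction k with
    | zero => intro t _; have := hc1 t; simp; linarith
    | succ k ih =>
      intro t ht
      have h1 := h t (by omega)
      have h2 := ih (t + 1) (by omega)
      have h3 := hN t (by omega)
      rw [Real.dist_eq, sub_zero] at h3
      have h4 := (abs_lt.1 h3).2
      rw [pow_succ]
      linarith
  obtain ⟨k, hk⟩ := exists_pow_lt_of_lt_one (half_pos hε) (by norm_num : (1 / 2 : ℝ) < 1)
  refine ⟨N + 1, fun t ht => ?_⟩
  rw [Real.dist_eq, sub_zero, abs_of_nonneg (hc0 t)]
  linarith [key k t ht]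

/-- Escape probability from a pair of certificates: a bounded function `K`, harmonic off `o` and
vanishing there, and a bounded function `f` that at least doubles in mean off `o`, such that `K` is
close to `1` wherever `f` is small. -/
theorem measure_avoid_eq_of_harmonic {p : S → S → ℝ≥0∞} {o : S} {μ : Measure (ℕ → S)}
    [IsProbabilityMeasure μ]
    (hμ : ∀ (n : ℕ) (x : ℕ → S), x 0 = o →
      μ {ω | ∀ i ≤ n, ω i = x i} = ∏ i ∈ Finset.range n, p (x i) (x (i + 1)))
    {K f : S → ℝ≥0∞} (hK1 : ∀ z, K z ≤ 1) (hKo : K o = 0)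
    (hK : ∀ z, z ≠ o → ∑' w, p z w * K w = K z)
    (hf1 : ∀ z, f z ≤ 1) (hf : ∀ z, z ≠ o → 2 * f z ≤ ∑' w, p z w * f w)
    (hKf : ∀ ε : ℝ≥0∞, ε ≠ 0 → ∃ C : ℝ≥0∞, C ≠ ⊤ ∧ ∀ z, 1 ≤ K z + ε + C * f z) :
    μ {ω | ∀ t, 1 ≤ t → ω t ≠ o} = ∑' w, p o w * K w := by
  have hE := measurableSet_avoidUpTo (S := S) o
  have hanti : Antitone (avoidUpTo o) := fun s t hst ω hω r h1 h2 => hω r h1 (h2.trans hst)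
  have hmem : ∀ t, 1 ≤ t → ∀ ω ∈ avoidUpTo o t, ω t ≠ o := fun t ht ω hω => hω t ht le_rfl
  have hlim : Tendsto (fun t => μ (avoidUpTo o t)) atTop
      (nhds (μ {ω | ∀ t, 1 ≤ t → ω t ≠ o})) := by
    have : {ω : ℕ → S | ∀ t, 1 ≤ t → ω t ≠ o} = ⋂ t, avoidUpTo o t := by
      ext ω
      simp only [avoidUpTo, Set.mem_ofPred_eq, Set.mem_iInter]
      exact ⟨fun h _ s hs _ => h s hs, fun h t ht => h t t ht le_rfl⟩
    rw [this]
    exact tendsto_measure_iInter_atTop (fun t => (hE t).nullMeasurableSet) hanti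
      ⟨0, measure_ne_top _ _⟩
  have hKconst : ∀ t, ∫⁻ ω in avoidUpTo o (t + 1), K (ω (t + 1)) ∂μ = ∑' w, p o w * K w := by
    intro t
    induction t with
    | zero =>
      have h := setLIntegral_avoidUpTo_next hμ K 0
      rw [hKo, zero_mul, add_zero] at h
      rw [← h]
      have hs : (avoidUpTo o 0 : Set (ℕ → S)) = Set.univ :=
        Set.eq_univ_of_forall fun ω s h1 h2 => by omega
      have h1 : μ {ω : ℕ → S | ω 0 = o} = 1 := by simpa using hμ 0 (fun _ => o) rfl
      have h2 : {ω : ℕ → S | ω 0 = o} ∈ ae μ :=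
        (mem_ae_iff_prob_eq_one (measurableSet_eq_at 0 o)).2 h1
      rw [hs, Measure.restrict_univ, lintegral_congr_ae (g := fun _ => ∑' w, p o w * K w)]
      · simp
      · filter_upwards [h2] with ω hω
        rw [hω]
    | succ t ih =>
      have h := setLIntegral_avoidUpTo_next hμ K (t + 1)
      rw [hKo, zero_mul, add_zero] at h
      rw [← h, ← ih]
      exact setLIntegral_congr_fun (hE _) fun ω hω => hK _ (hmem _ (by omega) ω hω)
  have hmeas : ∀ (g : S → ℝ≥0∞) (t : ℕ), Measurable fun ω : ℕ → S => g (ω t) := fun g t =>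
    (measurable_of_countable g).comp (measurable_pi_apply t)
  have hc : Tendsto (fun t => ∫⁻ ω in avoidUpTo o t, f (ω t) ∂μ) atTop (nhds 0) := by
    have hle : ∀ t, ∫⁻ ω in avoidUpTo o t, f (ω t) ∂μ ≤ 1 := fun t =>
      calc ∫⁻ ω in avoidUpTo o t, f (ω t) ∂μ ≤ ∫⁻ _ in avoidUpTo o t, 1 ∂μ :=
            lintegral_mono fun ω => hf1 _
        _ ≤ 1 := by rw [setLIntegral_one]; exact prob_le_one
    have hfin : ∀ t, ∫⁻ ω in avoidUpTo o t, f (ω t) ∂μ ≠ ⊤ := fun t =>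
      ((hle t).trans_lt ENNReal.one_lt_top).ne
    rw [← ENNReal.tendsto_toReal_iff hfin ENNReal.zero_ne_top]
    refine tendsto_zero_of_two_mul_le
      (q := fun t => (μ (avoidUpTo o t)).toReal - (μ (avoidUpTo o (t + 1))).toReal)
      (fun t => ENNReal.toReal_nonneg) (fun t => ?_) (fun t ht => ?_) ?_
    · simpa using ENNReal.toReal_mono ENNReal.one_ne_top (hle t)
    · have h1 : 2 * ∫⁻ ω in avoidUpTo o t, f (ω t) ∂μ ≤
          ∫⁻ ω in avoidUpTo o (t + 1), f (ω (t + 1)) ∂μ +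
            μ (avoidUpTo o t \ avoidUpTo o (t + 1)) := by
        rw [← lintegral_const_mul _ (hmeas f t)]
        calc ∫⁻ ω in avoidUpTo o t, 2 * f (ω t) ∂μ
            ≤ ∫⁻ ω in avoidUpTo o t, (∑' w, p (ω t) w * f w) ∂μ :=
              setLIntegral_mono' (hE t) fun ω hω => hf _ (hmem t ht ω hω)
          _ ≤ _ := by
              rw [setLIntegral_avoidUpTo_next hμ f t]
              gcongr
              exact mul_le_of_le_one_left' (hf1 o)
      have h2 := ENNReal.toReal_mono
        (ENNReal.add_ne_top.2 ⟨hfin _, measure_ne_top _ _⟩) h1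
      rw [ENNReal.toReal_add (hfin _) (measure_ne_top _ _), ENNReal.toReal_mul,
        measure_sdiff (hanti (Nat.le_succ t)) (hE _).nullMeasurableSet (measure_ne_top _ _),
        ENNReal.toReal_sub_of_le (measure_mono (hanti (Nat.le_succ t)))
          (measure_ne_top _ _)] at h2
      simpa using h2
    · have h := (ENNReal.tendsto_toReal (measure_ne_top μ _)).comp hlim
      simpa using h.sub (h.comp (tendsto_add_atTop_nat 1))
  refine le_antisymm ?_ ?_
  · refine ENNReal.le_of_forall_pos_le_add fun ε hε _ => ?_
    obtain ⟨C, hC, hCz⟩ := hKf ε (by exact_mod_cast hε.ne')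
    have hub : ∀ t, μ (avoidUpTo o (t + 1)) ≤ (∑' w, p o w * K w) + ε +
        C * ∫⁻ ω in avoidUpTo o (t + 1), f (ω (t + 1)) ∂μ := by
      intro t
      calc μ (avoidUpTo o (t + 1)) = ∫⁻ _ in avoidUpTo o (t + 1), 1 ∂μ := by simp
        _ ≤ ∫⁻ ω in avoidUpTo o (t + 1),
              (K (ω (t + 1)) + ε + C * f (ω (t + 1))) ∂μ := lintegral_mono fun ω => hCz _
        _ = ∫⁻ ω in avoidUpTo o (t + 1), K (ω (t + 1)) ∂μ + ε * μ (avoidUpTo o (t + 1)) +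
              C * ∫⁻ ω in avoidUpTo o (t + 1), f (ω (t + 1)) ∂μ := by
            rw [lintegral_add_left ((hmeas K _).add_const _), lintegral_add_left (hmeas K _),
              setLIntegral_const, lintegral_const_mul _ (hmeas f _)]
        _ ≤ _ := by
            rw [hKconst]
            gcongr
            exact mul_le_of_le_one_right' prob_le_one
    have h2 := (ENNReal.Tendsto.const_mul hc (Or.inr hC)).comp (tendsto_add_atTop_nat 1)
    have h3 := h2.const_add ((∑' w, p o w * K w) + (ε : ℝ≥0∞))
    rw [mul_zero, add_zero] at h3
    exact le_of_tendsto_of_tendsto' (hlim.comp (tendsto_add_atTop_nat 1)) h3 hub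
  · refine ge_of_tendsto' (hlim.comp (tendsto_add_atTop_nat 1)) fun t => ?_
    rw [← hKconst t]
    calc _ ≤ ∫⁻ _ in avoidUpTo o (t + 1), 1 ∂μ := lintegral_mono fun ω => hK1 _
      _ = _ := by simp

end KilledChain

section OneStep

variable {β : ℝ} {G : Set (Sym2 V)} {z : V}

lemma transProb_of_not_mem (hΛ : {u : V | s(z, u) ∈ G}.Nonempty) {w : V} (hw : s(z, w) ∉ G) :
    transProb β G z w = 0 := by
  rw [transProb, if_neg hΛ.ne_empty, if_neg hw]

lemma transProb_self_of_isolated (hΛ : {u : V | s(z, u) ∈ G} = ∅) (w : V) :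
    transProb β G z w = if w = z then 1 else 0 := by
  rw [transProb, if_pos hΛ]

lemma transProb_right {w : V} (hw : s(z, w) ∈ G) (hwz : w = (z.1 + 1, z.2)) :
    transProb β G z w = β / (β + ({u : V | s(z, u) ∈ G}.ncard : ℝ) - 1) := by
  have hΛ : {u : V | s(z, u) ∈ G}.Nonempty := ⟨w, hw⟩
  rw [transProb, if_neg hΛ.ne_empty, if_pos hw, if_pos (hwz ▸ hw), if_pos hwz]

lemma transProb_other {w : V} (hw : s(z, w) ∈ G) (hr : s(z, ((z.1 + 1, z.2) : V)) ∈ G)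
    (hwz : w ≠ (z.1 + 1, z.2)) :
    transProb β G z w = 1 / (β + ({u : V | s(z, u) ∈ G}.ncard : ℝ) - 1) := by
  have hΛ : {u : V | s(z, u) ∈ G}.Nonempty := ⟨w, hw⟩
  rw [transProb, if_neg hΛ.ne_empty, if_pos hw, if_pos hr, if_neg hwz]

lemma transProb_nonneg (hβ : 1 < β) (w : V) : 0 ≤ transProb β G z w := by
  have : 0 ≤ β + ({u : V | s(z, u) ∈ G}.ncard : ℝ) - 1 := by
    have : (0 : ℝ) ≤ ({u : V | s(z, u) ∈ G}.ncard : ℝ) := Nat.cast_nonneg _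
    linarith
  unfold transProb
  split_ifs <;> positivity

lemma le_transProb (hβ : 1 < β) (hfin : {u : V | s(z, u) ∈ G}.Finite)
    (hcard : {u : V | s(z, u) ∈ G}.ncard ≤ 4) {w : V} (hw : s(z, w) ∈ G) :
    1 / (β + 3) ≤ transProb β G z w := by
  have hΛ : {u : V | s(z, u) ∈ G}.Nonempty := ⟨w, hw⟩
  have h1 : (1 : ℝ) ≤ ({u : V | s(z, u) ∈ G}.ncard : ℝ) := by
    exact_mod_cast (Set.ncard_pos hfin).2 hΛ
  have h4 : ({u : V | s(z, u) ∈ G}.ncard : ℝ) ≤ 4 := by exact_mod_cast hcard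
  rw [transProb, if_neg hΛ.ne_empty, if_pos hw]
  split_ifs
  · exact div_le_div₀ (by linarith) hβ.le (by linarith) (by linarith)
  · exact div_le_div₀ (by linarith) le_rfl (by linarith) (by linarith)
  · exact div_le_div₀ (by linarith) le_rfl (by linarith) (by linarith)

lemma sum_transProb (hβ : 1 < β) (hfin : {u : V | s(z, u) ∈ G}.Finite)
    (hΛ : {u : V | s(z, u) ∈ G}.Nonempty) :
    ∑ w ∈ hfin.toFinset, transProb β G z w = 1 := by
  have h1 : (1 : ℝ) ≤ ({u : V | s(z, u) ∈ G}.ncard : ℝ) := by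
    exact_mod_cast (Set.ncard_pos hfin).2 hΛ
  have hc : (hfin.toFinset.card : ℝ) = ({u : V | s(z, u) ∈ G}.ncard : ℝ) := by
    rw [Set.ncard_eq_toFinset_card _ hfin]
  by_cases hr : s(z, ((z.1 + 1, z.2) : V)) ∈ G
  · have : ∀ w ∈ hfin.toFinset, transProb β G z w =
        (1 + if w = ((z.1 + 1, z.2) : V) then β - 1 else 0) /
          (β + ({u : V | s(z, u) ∈ G}.ncard : ℝ) - 1) := by
      intro w hw
      have hw' : s(z, w) ∈ G := by simpa using hw
      split_ifs with h
      · rw [transProb_right hw' h]; ring_nf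
      · rw [transProb_other hw' hr h, add_zero]
    rw [Finset.sum_congr rfl this, ← Finset.sum_div, Finset.sum_add_distrib,
      Finset.sum_ite_eq', if_pos (by simpa using hr), Finset.sum_const, nsmul_eq_mul, hc,
      div_eq_one_iff_eq (by linarith)]
    ring
  · have : ∀ w ∈ hfin.toFinset, transProb β G z w =
        1 / ({u : V | s(z, u) ∈ G}.ncard : ℝ) := by
      intro w hw
      have hw' : s(z, w) ∈ G := by simpa using hw
      rw [transProb, if_neg hΛ.ne_empty, if_pos hw', if_neg hr]
    rw [Finset.sum_congr rfl this, Finset.sum_const, nsmul_eq_mul, hc]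
    exact mul_one_div_cancel (by linarith)

lemma tsum_transProb_mul (hβ : 1 < β) (hfin : {u : V | s(z, u) ∈ G}.Finite)
    (hΛ : {u : V | s(z, u) ∈ G}.Nonempty) {k : V → ℝ} (hk : ∀ w, 0 ≤ k w) :
    ∑' w, ENNReal.ofReal (transProb β G z w) * ENNReal.ofReal (k w) =
      ENNReal.ofReal (k z + ∑ w ∈ hfin.toFinset, transProb β G z w * (k w - k z)) := by
  have hs : k z + ∑ w ∈ hfin.toFinset, transProb β G z w * (k w - k z) =
      ∑ w ∈ hfin.toFinset, transProb β G z w * k w := by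
    simp only [mul_sub, Finset.sum_sub_distrib, ← Finset.sum_mul, sum_transProb hβ hfin hΛ]
    ring
  rw [hs, ENNReal.ofReal_sum_of_nonneg fun w _ => mul_nonneg (transProb_nonneg hβ w) (hk w),
    tsum_eq_sum (s := hfin.toFinset)]
  · exact Finset.sum_congr rfl fun w _ => (ENNReal.ofReal_mul (transProb_nonneg hβ w)).symm
  · intro w hw
    rw [transProb_of_not_mem hΛ (by simpa using hw), ENNReal.ofReal_zero, zero_mul]

/-- The mean of `k` after one step when only horizontal moves change the value of `k`. -/
lemma tsum_transProb_mul_of_horizontal (hβ : 1 < β) (hfin : {u : V | s(z, u) ∈ G}.Finite)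
    (hr : s(z, ((z.1 + 1, z.2) : V)) ∈ G) (hl : s(z, ((z.1 - 1, z.2) : V)) ∈ G)
    {k : V → ℝ} (hk : ∀ w, 0 ≤ k w)
    (hkz : ∀ w, s(z, w) ∈ G → w ≠ (z.1 + 1, z.2) → w ≠ (z.1 - 1, z.2) → k w = k z) :
    ∑' w, ENNReal.ofReal (transProb β G z w) * ENNReal.ofReal (k w) =
      ENNReal.ofReal (k z + (β * (k (z.1 + 1, z.2) - k z) + (k (z.1 - 1, z.2) - k z)) /
        (β + ({u : V | s(z, u) ∈ G}.ncard : ℝ) - 1)) := by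
  rw [tsum_transProb_mul hβ hfin ⟨_, hr⟩ hk]
  have hne : ((z.1 + 1, z.2) : V) ≠ (z.1 - 1, z.2) := by
    intro h
    have := (Prod.ext_iff.1 h).1
    simp only at this
    omega
  rw [← Finset.sum_subset (s₁ := {((z.1 + 1, z.2) : V), (z.1 - 1, z.2)})]
  · rw [Finset.sum_pair hne, transProb_right hr rfl, transProb_other hl hr hne.symm]
    congr 2
    ring
  · intro w hw
    rcases Finset.mem_insert.1 hw with rfl | hw
    · simpa using hr
    · rw [Finset.mem_singleton.1 hw]; simpa using hl
  · intro w hw hw'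
    simp only [Finset.mem_insert, Finset.mem_singleton, not_or] at hw'
    rw [hkz w (by simpa using hw) hw'.1 hw'.2, sub_self, mul_zero]

end OneStep

section Geometry

variable {α : ℝ} {n₀ : ℕ}

/-- `z` is a vertex of the `m`-th warm-up trap. -/
def InTrap (α : ℝ) (m : ℕ) (z : V) : Prop :=
  (z.2 = 0 ∧ z.1 = dWarm m) ∨ (z.2 = 1 ∧ dWarm m - eWarm α m ≤ z.1 ∧ z.1 ≤ dWarm m) ∨
    (z.2 = 2 ∧ dWarm m - eWarm α m ≤ z.1 ∧ z.1 ≤ dWarm m - eWarm α m + cWarm m)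

/-- `w` is one of the four lattice neighbours of `z`. -/
def IsNeighbor (z w : V) : Prop :=
  (w.2 = z.2 ∧ (w.1 = z.1 + 1 ∨ w.1 = z.1 - 1)) ∨
    (w.1 = z.1 ∧ (w.2 = z.2 + 1 ∨ w.2 = z.2 - 1))

lemma warmupEdges_cases {z w : V} (h : s(z, w) ∈ warmupEdges α n₀) :
    IsNeighbor z w ∧ ((z.2 = 0 ∧ w.2 = 0 ∧ 0 ≤ z.1 ∧ 0 ≤ w.1) ∨
      ∃ m, n₀ ≤ m ∧ InTrap α m z ∧ InTrap α m w ∧ (z.2 ≠ 0 ∨ w.2 ≠ 0)) := by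
  obtain ⟨x, y⟩ := z
  obtain ⟨x', y'⟩ := w
  simp only [warmupEdges, trapEdgesAt, Set.mem_union, Set.mem_ofPred_eq, Set.mem_iUnion,
    Set.mem_insert_iff, Set.mem_singleton_iff, exists_prop, Sym2.eq_iff, Prod.mk.injEq] at h
  simp only [IsNeighbor, InTrap]
  rcases h with ⟨k, h⟩ | ⟨m, hm, (h | h) | ⟨i, hi, h⟩⟩
  · exact ⟨by omega, Or.inl (by omega)⟩
  · exact ⟨by omega, Or.inr ⟨m, hm, by omega, by omega, by omega⟩⟩
  · obtain ⟨i, hi, h⟩ := h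
    exact ⟨by omega, Or.inr ⟨m, hm, by omega, by omega, by omega⟩⟩
  · exact ⟨by omega, Or.inr ⟨m, hm, by omega, by omega, by omega⟩⟩

lemma axis_mem_warmupEdges {x : ℤ} (hx : 0 ≤ x) :
    s(((x, 0) : V), ((x + 1, 0) : V)) ∈ warmupEdges α n₀ :=
  Or.inl ⟨x.toNat, by rw [Int.toNat_of_nonneg hx]⟩

lemma trap_mem_warmupEdges {m : ℕ} (hm : n₀ ≤ m) {f : Sym2 V}
    (hf : f ∈ trapEdgesAt (dWarm m) 0 (eWarm α m) (cWarm m)) : f ∈ warmupEdges α n₀ :=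
  Or.inr (Set.mem_biUnion (show m ∈ {m : ℕ | n₀ ≤ m} from hm) hf)

lemma neighbors_subset (z : V) :
    {u : V | s(z, u) ∈ warmupEdges α n₀} ⊆
      (({(z.1 + 1, z.2), (z.1 - 1, z.2), (z.1, z.2 + 1), (z.1, z.2 - 1)} : Finset V) : Set V) := by
  rintro ⟨x, y⟩ hu
  have := (warmupEdges_cases hu).1
  simp only [IsNeighbor] at this
  simp only [Finset.coe_insert, Finset.coe_singleton, Set.mem_insert_iff, Set.mem_singleton_iff,
    Prod.mk.injEq]
  omega

lemma neighbors_finite (z : V) : {u : V | s(z, u) ∈ warmupEdges α n₀}.Finite :=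
  (Finset.finite_toSet _).subset (neighbors_subset z)

lemma neighbors_ncard_le (z : V) : {u : V | s(z, u) ∈ warmupEdges α n₀}.ncard ≤ 4 := by
  refine (Set.ncard_le_ncard (neighbors_subset z) (Finset.finite_toSet _)).trans ?_
  rw [Set.ncard_coe_finset]
  exact Finset.card_le_four

/-- A trap whose horizontal range contains the abscissa `x`. -/
def trapIndex (α : ℝ) (n₀ : ℕ) (x : ℤ) : ℕ :=
  Classical.epsilon fun m => n₀ ≤ m ∧ dWarm m - eWarm α m ≤ x ∧
    (x ≤ dWarm m ∨ x ≤ dWarm m - eWarm α m + cWarm m)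

/-- The abscissa of the projection of `z` to the axis, each trap being projected to its anchor. -/
def anchorPos (α : ℝ) (n₀ : ℕ) (z : V) : ℤ :=
  if z.2 = 0 then z.1 else dWarm (trapIndex α n₀ z.1)

/-- The graph distance from `z` to its projection on the axis. -/
def depth (α : ℝ) (n₀ : ℕ) (z : V) : ℕ :=
  if z.2 = 0 then 0 else
    if z.2 = 1 then (1 + dWarm (trapIndex α n₀ z.1) - z.1).toNat
    else (2 + eWarm α (trapIndex α n₀ z.1) +
      (z.1 - (dWarm (trapIndex α n₀ z.1) - eWarm α (trapIndex α n₀ z.1)))).toNat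

lemma trapIndex_eq (hsep : WarmupSeparated α n₀) {m : ℕ} (hm : n₀ ≤ m) {z : V}
    (hz : InTrap α m z) (hz0 : z.2 ≠ 0) : trapIndex α n₀ z.1 = m := by
  have hP : ∃ m, n₀ ≤ m ∧ dWarm m - eWarm α m ≤ z.1 ∧
      (z.1 ≤ dWarm m ∨ z.1 ≤ dWarm m - eWarm α m + cWarm m) := by
    refine ⟨m, hm, ?_⟩
    simp only [InTrap] at hz
    omega
  obtain ⟨h1, h2⟩ := Classical.epsilon_spec hP
  change dWarm (trapIndex α n₀ z.1) - eWarm α (trapIndex α n₀ z.1) ≤ z.1 ∧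
    (z.1 ≤ dWarm (trapIndex α n₀ z.1) ∨ z.1 ≤ dWarm (trapIndex α n₀ z.1) -
      eWarm α (trapIndex α n₀ z.1) + cWarm (trapIndex α n₀ z.1)) at h2
  change n₀ ≤ trapIndex α n₀ z.1 at h1
  simp only [InTrap] at hz
  rcases lt_trichotomy (trapIndex α n₀ z.1) m with h | h | h
  · have := hsep _ _ h1 h; omega
  · exact h
  · have := hsep _ _ hm h; omega

lemma anchorPos_eq (hsep : WarmupSeparated α n₀) {m : ℕ} (hm : n₀ ≤ m) {z : V}
    (hz : InTrap α m z) : anchorPos α n₀ z = dWarm m := by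
  unfold anchorPos
  split_ifs with h
  · simp only [InTrap] at hz; omega
  · rw [trapIndex_eq hsep hm hz h]

lemma dWarm_pos {m : ℕ} (hm : 1 ≤ m) : 1 ≤ dWarm m := by
  unfold dWarm
  exact_mod_cast Nat.one_le_pow 3 m hm

lemma le_dWarm (m : ℕ) : (m : ℤ) ≤ dWarm m := by
  unfold dWarm
  exact_mod_cast Nat.le_self_pow (by norm_num) m

/-- Vertices of the warm-up graph. -/
lemma vertex_cases (hn₀ : 1 ≤ n₀) {z : V} (hz : {u : V | s(z, u) ∈ warmupEdges α n₀}.Nonempty) :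
    (z.2 = 0 ∧ 0 ≤ z.1) ∨ (z.2 ≠ 0 ∧ ∃ m, n₀ ≤ m ∧ InTrap α m z) := by
  obtain ⟨w, hw⟩ := hz
  rcases (warmupEdges_cases hw).2 with h | ⟨m, hm, h, -⟩
  · exact Or.inl ⟨h.1, h.2.2.1⟩
  · by_cases h0 : z.2 = 0
    · have := dWarm_pos (hn₀.trans hm)
      refine Or.inl ⟨h0, ?_⟩
      simp only [InTrap] at h
      omega
    · exact Or.inr ⟨h0, m, hm, h⟩

lemma anchorPos_eq_or (hsep : WarmupSeparated α n₀) {z w : V}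
    (h : s(z, w) ∈ warmupEdges α n₀) :
    anchorPos α n₀ w = anchorPos α n₀ z ∨
      (z.2 = 0 ∧ w.2 = 0 ∧ (w.1 = z.1 + 1 ∨ w.1 = z.1 - 1)) := by
  obtain ⟨h1, h2 | ⟨m, hm, hz, hw, -⟩⟩ := warmupEdges_cases h
  · right
    simp only [IsNeighbor] at h1
    omega
  · left
    rw [anchorPos_eq hsep hm hz, anchorPos_eq hsep hm hw]

/-- The distance from `z` to the axis vertex `(d, 0)`. -/
def anchorDist (α : ℝ) (n₀ : ℕ) (d : ℤ) (z : V) : ℕ :=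
  (anchorPos α n₀ z - d).natAbs + depth α n₀ z

lemma exists_neighbor_anchorDist_lt (hn₀ : 1 ≤ n₀) (hsep : WarmupSeparated α n₀) {d : ℤ}
    (hd : 0 ≤ d) {z : V} (hz : {u : V | s(z, u) ∈ warmupEdges α n₀}.Nonempty)
    (hzd : z ≠ (d, 0)) :
    ∃ w, s(z, w) ∈ warmupEdges α n₀ ∧ anchorDist α n₀ d w < anchorDist α n₀ d z := by
  rcases vertex_cases hn₀ hz with ⟨h0, hx⟩ | ⟨h0, m, hm, hT⟩
  · obtain ⟨x, y⟩ := z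
    simp only at h0 hx
    subst h0
    have hxd : x ≠ d := fun h => hzd (by rw [h])
    rcases lt_or_gt_of_ne hxd with h | h
    · refine ⟨(x + 1, 0), axis_mem_warmupEdges hx, ?_⟩
      simp only [anchorDist, anchorPos, depth, if_true]
      omega
    · refine ⟨(x - 1, 0), ?_, ?_⟩
      · have := axis_mem_warmupEdges (α := α) (n₀ := n₀) (x := x - 1) (by omega)
        rwa [sub_add_cancel, Sym2.eq_swap] at this
      · simp only [anchorDist, anchorPos, depth, if_true]
        omega
  · suffices H : ∃ w, s(z, w) ∈ trapEdgesAt (dWarm m) 0 (eWarm α m) (cWarm m) ∧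
        InTrap α m w ∧ depth α n₀ w < depth α n₀ z by
      obtain ⟨w, hw, hwT, hlt⟩ := H
      refine ⟨w, trap_mem_warmupEdges hm hw, ?_⟩
      simp only [anchorDist, anchorPos_eq hsep hm hT, anchorPos_eq hsep hm hwT]
      omega
    have hdep : ∀ w : V, w.2 ≠ 0 → InTrap α m w → depth α n₀ w =
        if w.2 = 1 then (1 + dWarm m - w.1).toNat
        else (2 + eWarm α m + (w.1 - (dWarm m - eWarm α m))).toNat := by
      intro w hw hwT
      simp only [depth, if_neg hw, trapIndex_eq hsep hm hwT hw]
    have hdz := hdep z h0 hT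
    obtain ⟨x, y⟩ := z
    simp only [trapEdgesAt, Set.mem_union, Set.mem_ofPred_eq, Set.mem_insert_iff,
      Set.mem_singleton_iff, Sym2.eq_iff, Prod.mk.injEq]
    rcases hT with h | ⟨rfl : y = 1, h⟩ | ⟨rfl : y = 2, h⟩
    · exact absurd h.1 h0
    · simp only [if_true] at hdz
      simp only at h
      by_cases hxd : x = dWarm m
      · refine ⟨(dWarm m, 0), by left; left; left; simp [hxd], Or.inl ⟨rfl, rfl⟩, ?_⟩
        rw [hdz]
        simp only [depth, if_true]
        omega
      · have hT' : InTrap α m (x + 1, 1) := Or.inr (Or.inl ⟨rfl, by simp only; omega⟩)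
        refine ⟨(x + 1, 1), ?_, hT', ?_⟩
        · left; right
          exact ⟨(x - (dWarm m - eWarm α m)).toNat, by omega, by left; simp only [Prod.mk.injEq]; omega⟩
        · rw [hdz, hdep _ (by simp) hT']
          simp only [if_true]
          omega
    · norm_num at hdz
      simp only at h
      by_cases hxd : x = dWarm m - eWarm α m
      · have hT' : InTrap α m (x, 1) := Or.inr (Or.inl ⟨rfl, by simp only; omega⟩)
        refine ⟨(x, 1), by left; left; right; right; simp [hxd], hT', ?_⟩
        rw [hdz, hdep _ (by simp) hT']
        simp only [if_true]
        omega
      · have hT' : InTrap α m (x - 1, 2) := Or.inr (Or.inr ⟨rfl, by simp only; omega⟩)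
        refine ⟨(x - 1, 2), ?_, hT', ?_⟩
        · right
          exact ⟨(x - 1 - (dWarm m - eWarm α m)).toNat, by omega, by right; simp only [Prod.mk.injEq]; omega⟩
        · rw [hdz, hdep _ (by simp) hT']
          norm_num
          omega

lemma exists_anchorDist_le (hn₀ : 1 ≤ n₀) (hsep : WarmupSeparated α n₀) (d R : ℤ) :
    ∃ B : ℕ, ∀ z, {u : V | s(z, u) ∈ warmupEdges α n₀}.Nonempty → anchorPos α n₀ z ≤ R →
      anchorDist α n₀ d z ≤ B := by
  refine ⟨R.natAbs + d.natAbs +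
    ∑ m ∈ Finset.range (R.toNat + 1), (2 + 2 * eWarm α m + cWarm m), fun z hz hR => ?_⟩
  rcases vertex_cases hn₀ hz with ⟨h0, hx⟩ | ⟨h0, m, hm, hT⟩
  · simp only [anchorDist, anchorPos, depth, if_pos h0] at hR ⊢
    omega
  · have hI := trapIndex_eq hsep hm hT h0
    have hp := anchorPos_eq hsep hm hT
    have hm1 := le_dWarm m
    have hle : 2 + 2 * eWarm α m + cWarm m ≤
        ∑ m ∈ Finset.range (R.toNat + 1), (2 + 2 * eWarm α m + cWarm m) :=
      Finset.single_le_sum (f := fun m => 2 + 2 * eWarm α m + cWarm m)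
        (fun _ _ => Nat.zero_le _) (Finset.mem_range.2 (by omega))
    have hdep : depth α n₀ z ≤ 2 + 2 * eWarm α m + cWarm m := by
      simp only [depth, if_neg h0, hI]
      simp only [InTrap] at hT
      split_ifs <;> omega
    simp only [anchorDist]
    omega

lemma neighbors_anchor (hn₀ : 1 ≤ n₀) {n : ℕ} (hn : n₀ ≤ n) :
    {u : V | s(((dWarm n, 0) : V), u) ∈ warmupEdges α n₀} =
      (({(dWarm n + 1, 0), (dWarm n - 1, 0), (dWarm n, 1)} : Finset V) : Set V) := by
  have hd := dWarm_pos (hn₀.trans hn)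
  ext ⟨x, y⟩
  simp only [Set.mem_ofPred_eq, Finset.coe_insert, Finset.coe_singleton, Set.mem_insert_iff,
    Set.mem_singleton_iff]
  constructor
  · intro h
    obtain ⟨h1, h2⟩ := warmupEdges_cases h
    simp only [IsNeighbor] at h1
    simp only [Prod.mk.injEq]
    rcases h2 with h2 | ⟨m, hm, -, hT, -⟩
    · omega
    · simp only [InTrap] at hT
      omega
  · rintro (h | h | h) <;> rw [h]
    · exact axis_mem_warmupEdges (by omega)
    · have := axis_mem_warmupEdges (α := α) (n₀ := n₀) (x := dWarm n - 1) (by omega)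
      rwa [sub_add_cancel, Sym2.eq_swap] at this
    · exact trap_mem_warmupEdges hn (by simp [trapEdgesAt])

end Geometry

section Certificates

variable {α β : ℝ} {n₀ : ℕ}

open scoped Classical in
/-- The probability of never hitting `(d, 0)` (isolated vertices included). -/
def escapeFun (α β : ℝ) (n₀ : ℕ) (d : ℤ) (z : V) : ℝ :=
  if {u : V | s(z, u) ∈ warmupEdges α n₀} = ∅ then 1
  else 1 - β⁻¹ ^ (anchorPos α n₀ z - d).toNat

open scoped Classical in
/-- A function that at least doubles in mean at each step taken away from `(d, 0)`. -/
def growthFun (α β : ℝ) (n₀ : ℕ) (d : ℤ) (z : V) : ℝ :=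
  if {u : V | s(z, u) ∈ warmupEdges α n₀} = ∅ then 0
  else (1 / (2 * (β + 3))) ^ anchorDist α n₀ d z

lemma escapeFun_of_nonempty {d : ℤ} {z : V} (hz : {u : V | s(z, u) ∈ warmupEdges α n₀}.Nonempty) :
    escapeFun α β n₀ d z = 1 - β⁻¹ ^ (anchorPos α n₀ z - d).toNat :=
  if_neg hz.ne_empty

lemma growthFun_of_nonempty {d : ℤ} {z : V} (hz : {u : V | s(z, u) ∈ warmupEdges α n₀}.Nonempty) :
    growthFun α β n₀ d z = (1 / (2 * (β + 3))) ^ anchorDist α n₀ d z :=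
  if_neg hz.ne_empty

lemma escapeFun_nonneg (hβ : 1 < β) (d : ℤ) (z : V) : 0 ≤ escapeFun α β n₀ d z := by
  unfold escapeFun
  split_ifs
  · exact zero_le_one
  · exact sub_nonneg.2 (pow_le_one₀ (by positivity) (inv_le_one_of_one_le₀ hβ.le))

lemma escapeFun_le_one (hβ : 1 < β) (d : ℤ) (z : V) : escapeFun α β n₀ d z ≤ 1 := by
  unfold escapeFun
  split_ifs
  · exact le_rfl
  · exact sub_le_self _ (by positivity)

lemma growthFun_nonneg (hβ : 1 < β) (d : ℤ) (z : V) : 0 ≤ growthFun α β n₀ d z := by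
  unfold growthFun
  split_ifs <;> positivity

lemma growthFun_le_one (hβ : 1 < β) (d : ℤ) (z : V) : growthFun α β n₀ d z ≤ 1 := by
  unfold growthFun
  split_ifs
  · exact zero_le_one
  · exact pow_le_one₀ (by positivity) ((div_le_one (by linarith)).2 (by linarith))

lemma nonempty_of_mem {z w : V} (h : s(z, w) ∈ warmupEdges α n₀) :
    {u : V | s(w, u) ∈ warmupEdges α n₀}.Nonempty :=
  ⟨z, by rw [Set.mem_ofPred_eq, Sym2.eq_swap]; exact h⟩

lemma tsum_isolated {G : Set (Sym2 V)} {z : V} (hz : {u : V | s(z, u) ∈ G} = ∅) (g : V → ℝ≥0∞) :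
    ∑' w, ENNReal.ofReal (transProb β G z w) * g w = g z := by
  rw [tsum_eq_single z]
  · rw [transProb_self_of_isolated hz, if_pos rfl, ENNReal.ofReal_one, one_mul]
  · intro w hw
    rw [transProb_self_of_isolated hz, if_neg hw, ENNReal.ofReal_zero, zero_mul]

lemma two_mul_growthFun_le (hn₀ : 1 ≤ n₀) (hsep : WarmupSeparated α n₀) (hβ : 1 < β) {d : ℤ}
    (hd : 0 ≤ d) {z : V} (hz : z ≠ (d, 0)) :
    2 * ENNReal.ofReal (growthFun α β n₀ d z) ≤
      ∑' w, ENNReal.ofReal (transProb β (warmupEdges α n₀) z w) *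
        ENNReal.ofReal (growthFun α β n₀ d w) := by
  rcases Set.eq_empty_or_nonempty {u : V | s(z, u) ∈ warmupEdges α n₀} with hΛ | hΛ
  · simp [growthFun, hΛ]
  obtain ⟨w, hw, hlt⟩ := exists_neighbor_anchorDist_lt hn₀ hsep hd hΛ hz
  refine le_trans ?_ (ENNReal.le_tsum w)
  rw [← ENNReal.ofReal_mul (transProb_nonneg hβ w), ← ENNReal.ofReal_ofNat 2,
    ← ENNReal.ofReal_mul (by norm_num), growthFun_of_nonempty hΛ,
    growthFun_of_nonempty (nonempty_of_mem hw)]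
  refine ENNReal.ofReal_le_ofReal ?_
  have hθ1 : 1 / (2 * (β + 3)) ≤ 1 := (div_le_one (by linarith)).2 (by linarith)
  calc 2 * (1 / (2 * (β + 3))) ^ anchorDist α n₀ d z
      ≤ 2 * (1 / (2 * (β + 3))) ^ (anchorDist α n₀ d w + 1) := by
        gcongr 2 * ?_
        exact pow_le_pow_of_le_one (by positivity) hθ1 hlt
    _ = 1 / (β + 3) * (1 / (2 * (β + 3))) ^ anchorDist α n₀ d w := by
        rw [pow_succ]
        field_simp
    _ ≤ _ := by
        gcongr
        exact le_transProb hβ (neighbors_finite z) (neighbors_ncard_le z) hw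

lemma escapeFun_axis (d : ℤ) {x : ℤ} (hx : 0 ≤ x) :
    escapeFun α β n₀ d (x, 0) = 1 - β⁻¹ ^ (x - d).toNat :=
  escapeFun_of_nonempty ⟨_, axis_mem_warmupEdges hx⟩

lemma tsum_escapeFun_axis (hsep : WarmupSeparated α n₀) (hβ : 1 < β) {d x : ℤ} (hd : 1 ≤ d)
    (hx : d ≤ x) :
    ∑' w, ENNReal.ofReal (transProb β (warmupEdges α n₀) (x, 0) w) *
        ENNReal.ofReal (escapeFun α β n₀ d w) =
      ENNReal.ofReal (1 - β⁻¹ ^ (x - d).toNat + (β * (β⁻¹ ^ (x - d).toNat -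
        β⁻¹ ^ (x + 1 - d).toNat) + (β⁻¹ ^ (x - d).toNat - β⁻¹ ^ (x - 1 - d).toNat)) /
        (β + ({u : V | s(((x, 0) : V), u) ∈ warmupEdges α n₀}.ncard : ℝ) - 1)) := by
  have hr : s(((x, 0) : V), ((x + 1, 0) : V)) ∈ warmupEdges α n₀ :=
    axis_mem_warmupEdges (by omega)
  have hl : s(((x, 0) : V), ((x - 1, 0) : V)) ∈ warmupEdges α n₀ := by
    have := axis_mem_warmupEdges (α := α) (n₀ := n₀) (x := x - 1) (by omega)
    rwa [sub_add_cancel, Sym2.eq_swap] at this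
  rw [tsum_transProb_mul_of_horizontal hβ (neighbors_finite _) hr hl (escapeFun_nonneg hβ d)]
  · simp only
    rw [escapeFun_axis d (by omega), escapeFun_axis d (by omega),
      escapeFun_axis d (by omega)]
    congr 3
    ring
  · intro w hw hwr hwl
    rw [escapeFun_of_nonempty (nonempty_of_mem hw), escapeFun_of_nonempty ⟨w, hw⟩]
    rcases anchorPos_eq_or hsep hw with h | ⟨-, h0, h | h⟩
    · rw [h]
    · exact absurd (Prod.ext h h0) hwr
    · exact absurd (Prod.ext h h0) hwl

lemma tsum_escapeFun (hsep : WarmupSeparated α n₀) (hβ : 1 < β) {d : ℤ}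
    (hd : 1 ≤ d) {z : V} (hz : z ≠ (d, 0)) :
    ∑' w, ENNReal.ofReal (transProb β (warmupEdges α n₀) z w) *
        ENNReal.ofReal (escapeFun α β n₀ d w) = ENNReal.ofReal (escapeFun α β n₀ d z) := by
  rcases Set.eq_empty_or_nonempty {u : V | s(z, u) ∈ warmupEdges α n₀} with hΛ | hΛ
  · exact tsum_isolated hΛ _
  by_cases hax : z.2 = 0 ∧ d ≤ z.1
  · obtain ⟨x, y⟩ := z
    obtain ⟨rfl : y = 0, hx : d ≤ x⟩ := hax
    have hxd : x ≠ d := fun h => hz (by rw [h])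
    rw [tsum_escapeFun_axis hsep hβ hd hx, escapeFun_axis d (by omega)]
    obtain ⟨j, hj⟩ : ∃ j : ℕ, x - d = j + 1 := ⟨(x - d - 1).toNat, by omega⟩
    have h1 : (x - d).toNat = j + 1 := by omega
    have h2 : (x + 1 - d).toNat = j + 2 := by omega
    have h3 : (x - 1 - d).toNat = j := by omega
    have hβ0 : β ≠ 0 := by linarith
    have : β * (β⁻¹ ^ (j + 1) - β⁻¹ ^ (j + 2)) + (β⁻¹ ^ (j + 1) - β⁻¹ ^ j) = 0 := by
      simp only [pow_succ]
      field_simp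
      ring
    rw [h1, h2, h3, this, zero_div, add_zero]
  · rw [tsum_transProb_mul hβ (neighbors_finite z) hΛ (escapeFun_nonneg hβ d),
      Finset.sum_eq_zero, add_zero]
    intro w hw
    have hw' : s(z, w) ∈ warmupEdges α n₀ := by simpa using hw
    rw [escapeFun_of_nonempty (nonempty_of_mem hw'), escapeFun_of_nonempty hΛ]
    have : (anchorPos α n₀ w - d).toNat = (anchorPos α n₀ z - d).toNat := by
      rcases anchorPos_eq_or hsep hw' with h | ⟨h0, h0', h⟩
      · rw [h]
      · simp only [anchorPos, if_pos h0, if_pos h0']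
        omega
    rw [this, sub_self, mul_zero]

lemma tsum_escapeFun_anchor (hn₀ : 1 ≤ n₀) (hsep : WarmupSeparated α n₀) (hβ : 1 < β) {n : ℕ}
    (hn : n₀ ≤ n) :
    ∑' w, ENNReal.ofReal (transProb β (warmupEdges α n₀) (dWarm n, 0) w) *
        ENNReal.ofReal (escapeFun α β n₀ (dWarm n) w) =
      ENNReal.ofReal ((β - 1) / (β + 2)) := by
  rw [tsum_escapeFun_axis hsep hβ (dWarm_pos (hn₀.trans hn)) le_rfl, neighbors_anchor hn₀ hn,
    Set.ncard_coe_finset]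
  have hcard : ({(dWarm n + 1, 0), (dWarm n - 1, 0), (dWarm n, 1)} : Finset V).card = 3 := by
    rw [Finset.card_eq_three]
    exact ⟨_, _, _, by simp only [ne_eq, Prod.mk.injEq]; omega, by simp, by simp, rfl⟩
  have h1 : (dWarm n + 1 - dWarm n).toNat = 1 := by omega
  have h2 : (dWarm n - 1 - dWarm n).toNat = 0 := by omega
  have hβ0 : β ≠ 0 := by linarith
  rw [hcard, h1, h2, sub_self]
  congr 1
  simp only [Int.toNat_zero, pow_zero, pow_one, sub_self, zero_add, add_zero]
  congr 1
  · field_simp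
  · push_cast; ring

lemma exists_one_le_escapeFun_add (hn₀ : 1 ≤ n₀) (hsep : WarmupSeparated α n₀) (hβ : 1 < β)
    (d : ℤ) {ε : ℝ≥0∞} (hε : ε ≠ 0) :
    ∃ C : ℝ≥0∞, C ≠ ⊤ ∧ ∀ z, 1 ≤ ENNReal.ofReal (escapeFun α β n₀ d z) + ε +
      C * ENNReal.ofReal (growthFun α β n₀ d z) := by
  obtain ⟨r, hr, hrε⟩ : ∃ r : ℝ, 0 < r ∧ ENNReal.ofReal r ≤ ε := by
    rcases eq_or_ne ε ⊤ with rfl | h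
    · exact ⟨1, one_pos, le_top⟩
    · exact ⟨ε.toReal, ENNReal.toReal_pos hε h, (ENNReal.ofReal_toReal h).le⟩
  have hq : β⁻¹ < 1 := inv_lt_one_of_one_lt₀ hβ
  obtain ⟨N, hN⟩ := exists_pow_lt_of_lt_one hr hq
  obtain ⟨B, hB⟩ := exists_anchorDist_le hn₀ hsep d (d + N)
  have hθ : 0 < 1 / (2 * (β + 3)) := by positivity
  have hθ1 : 1 / (2 * (β + 3)) ≤ 1 := (div_le_one (by linarith)).2 (by linarith)
  refine ⟨ENNReal.ofReal (((1 / (2 * (β + 3))) ^ B)⁻¹), ENNReal.ofReal_ne_top, fun z => ?_⟩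
  have hK := escapeFun_nonneg (α := α) (n₀ := n₀) hβ d z
  have hf := growthFun_nonneg (α := α) (n₀ := n₀) hβ d z
  have hC : 0 ≤ ((1 / (2 * (β + 3))) ^ B)⁻¹ := by positivity
  suffices H : 1 ≤ escapeFun α β n₀ d z + r +
      ((1 / (2 * (β + 3))) ^ B)⁻¹ * growthFun α β n₀ d z by
    calc (1 : ℝ≥0∞) = ENNReal.ofReal 1 := ENNReal.ofReal_one.symm
      _ ≤ _ := ENNReal.ofReal_le_ofReal H
      _ = ENNReal.ofReal (escapeFun α β n₀ d z) + ENNReal.ofReal r +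
            ENNReal.ofReal (((1 / (2 * (β + 3))) ^ B)⁻¹) *
              ENNReal.ofReal (growthFun α β n₀ d z) := by
          rw [ENNReal.ofReal_add (by positivity) (by positivity),
            ENNReal.ofReal_add hK hr.le, ENNReal.ofReal_mul hC]
      _ ≤ _ := by gcongr
  rcases Set.eq_empty_or_nonempty {u : V | s(z, u) ∈ warmupEdges α n₀} with hΛ | hΛ
  · have : escapeFun α β n₀ d z = 1 := by simp [escapeFun, hΛ]
    rw [this]
    nlinarith [mul_nonneg hC hf]
  rcases le_total (anchorPos α n₀ z) (d + N) with h | h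
  · have : 1 ≤ ((1 / (2 * (β + 3))) ^ B)⁻¹ * growthFun α β n₀ d z := by
      rw [growthFun_of_nonempty hΛ, inv_mul_eq_div, one_le_div (by positivity)]
      exact pow_le_pow_of_le_one hθ.le hθ1 (hB z hΛ h)
    linarith
  · have h1 : β⁻¹ ^ (anchorPos α n₀ z - d).toNat ≤ β⁻¹ ^ N :=
      pow_le_pow_of_le_one (by positivity) hq.le (by omega)
    have h2 := mul_nonneg hC hf
    rw [escapeFun_of_nonempty hΛ]
    linarith

end Certificates

/-- In the warm-up configuration, the β-biased walk started at the anchor `(n³, 0)` of a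
present trap never returns to the anchor with probability exactly `(β-1)/(β+2)`. -/
theorem escape_probability_at_anchor (α : ℝ) (hα : 0 < α) (n₀ : ℕ) (hn₀ : 1 ≤ n₀)
    (hsep : WarmupSeparated α n₀) (n : ℕ) (hn : n₀ ≤ n) (β : ℝ) (hβ : 1 < β)
    (μ : Measure (ℕ → V))
    (hμ : IsWalkLaw β (warmupEdges α n₀) ((dWarm n, 0) : V) μ) :
    μ {ω | ∀ t : ℕ, 1 ≤ t → ω t ≠ ((dWarm n, 0) : V)} =
      ENNReal.ofReal ((β - 1) / (β + 2)) := by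
  have := hμ.1
  have hd := dWarm_pos (hn₀.trans hn)
  have hcyl : ∀ (k : ℕ) (x : ℕ → V), x 0 = ((dWarm n, 0) : V) →
      μ {ω | ∀ i ≤ k, ω i = x i} = ∏ i ∈ Finset.range k,
        ENNReal.ofReal (transProb β (warmupEdges α n₀) (x i) (x (i + 1))) := fun k x hx => by
    rw [hμ.2 k x hx, ENNReal.ofReal_prod_of_nonneg fun i _ => transProb_nonneg hβ _]
  rw [← tsum_escapeFun_anchor hn₀ hsep hβ hn]
  refine measure_avoid_eq_of_harmonic (S := V)
    (p := fun z w => ENNReal.ofReal (transProb β (warmupEdges α n₀) z w)) hcyl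
    (K := fun z => ENNReal.ofReal (escapeFun α β n₀ (dWarm n) z))
    (f := fun z => ENNReal.ofReal (growthFun α β n₀ (dWarm n) z))
    (fun z => ENNReal.ofReal_le_one.2 (escapeFun_le_one hβ _ z)) ?_
    (fun z hz => tsum_escapeFun hsep hβ hd hz)
    (fun z => ENNReal.ofReal_le_one.2 (growthFun_le_one hβ _ z))
    (fun z hz => two_mul_growthFun_le hn₀ hsep hβ (by omega) hz)
    (fun ε hε => exists_one_le_escapeFun_add hn₀ hsep hβ _ hε)
  rw [escapeFun_axis _ (by omega)]
  simp

end
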